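/- arXiv:1305.4377 — 7 statements merged into one kernel-verified Lean document; each statement's English description precedes it below -/
import Mathlib

section
/- Suppose F : ℤ × ℕ → ℕ and G : ℤ × ℕ → ℕ satisfy: F(r,s)=0 for all r ≤ 0 and all s; G(d,0)=1 for all d ≥ 1; G(d,s)=F(d−s,s) for all d ≥ 1 and s ≥ 1; and F(d,s)=∑_{i=0}^{s} C(s,i)·G(d,i) for all d ≥ 1 and s ≥ 0. Then G(d,s)=C(d−1,s) for all integers d ≥ 1 and all natural numbers s. -/
/-- Vandermonde's identity with the first lower index reflected. -/
theorem Nat.sum_range_choose_mul_choose_eq_add_choose (s m : ℕ) :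
    ∑ i ∈ Finset.range (s + 1), s.choose i * m.choose i = (m + s).choose s := by
  rw [Nat.add_choose_eq, Finset.Nat.sum_antidiagonal_eq_sum_range_succ_mk]
  refine Finset.sum_congr rfl fun i hi => ?_
  rw [Nat.choose_symm (Finset.mem_range_succ_iff.mp hi), mul_comm]

/-- **Proposition 4.5.** If `F, G : ℤ × ℕ → ℕ` satisfy `F(r,s) = 0` for `r ≤ 0`,
`G(d,0) = 1` for `d ≥ 1`, `G(d,s) = F(d-s,s)` for `d ≥ 1`, `s ≥ 1`, and
`F(d,s) = ∑_{i=0}^{s} C(s,i)·G(d,i)` for `d ≥ 1`, then `G(d,s) = C(d-1,s)` for `d ≥ 1`. -/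
theorem G_eq_choose (F G : ℤ × ℕ → ℕ)
    (hF0 : ∀ r : ℤ, r ≤ 0 → ∀ s : ℕ, F (r, s) = 0)
    (hG0 : ∀ d : ℤ, 1 ≤ d → G (d, 0) = 1)
    (hGF : ∀ d : ℤ, 1 ≤ d → ∀ s : ℕ, 1 ≤ s → G (d, s) = F (d - (s : ℤ), s))
    (hFG : ∀ d : ℤ, 1 ≤ d → ∀ s : ℕ,
      F (d, s) = ∑ i ∈ Finset.range (s + 1), Nat.choose s i * G (d, i)) :
    ∀ d : ℤ, 1 ≤ d → ∀ s : ℕ, G (d, s) = Nat.choose (d - 1).toNat s := by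
  have key : ∀ n s : ℕ, G ((n : ℤ) + 1, s) = n.choose s := by
    intro n
    induction n using Nat.strong_induction_on with
    | _ n ih =>
      intro s
      rcases Nat.eq_zero_or_pos s with rfl | hs
      · rw [hG0 _ (by lia), Nat.choose_zero_right]
      rw [hGF _ (by lia) s hs]
      rcases lt_or_ge n s with hns | hsn
      · rw [hF0 _ (by lia), Nat.choose_eq_zero_of_lt hns]
      · obtain ⟨m, rfl⟩ := Nat.exists_eq_add_of_le' hsn
        have hd : ((m + s : ℕ) : ℤ) + 1 - s = (m : ℤ) + 1 := by push_cast; ring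
        rw [hd, hFG _ (by lia), ← Nat.sum_range_choose_mul_choose_eq_add_choose]
        exact Finset.sum_congr rfl fun i _ => by rw [ih m (by lia)]
  intro d hd s
  rw [← key, Int.toNat_of_nonneg (by lia), sub_add_cancel]
end

section
/- Suppose F : ℤ × ℕ → ℕ and G : ℤ × ℕ → ℕ satisfy: F(r,s)=0 for all r ≤ 0 and all s; G(d,0)=1 for all d ≥ 1; G(d,s)=F(d−s,s) for all d ≥ 1 and s ≥ 1; and F(d,s)=∑_{i=0}^{s} C(s,i)·G(d,i) for all d ≥ 1 and s ≥ 0. Then F(d,s)=C(d+s−1,s) for all integers d ≥ 1 and all natural numbers s. -/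
theorem Nat.sum_range_choose_mul_choose (n s : ℕ) :
    ∑ i ∈ Finset.range (s + 1), s.choose i * n.choose i = (n + s).choose s := by
  rw [Nat.add_choose_eq, Finset.Nat.sum_antidiagonal_eq_sum_range_succ_mk]
  refine Finset.sum_congr rfl fun i hi => ?_
  rw [Nat.choose_symm (Finset.mem_range_succ_iff.mp hi), mul_comm]

/-- **Lemma 4.6 input: closed form for F.** If `F, G : ℤ × ℕ → ℕ` satisfy `F(r,s) = 0` for `r ≤ 0`,
`G(d,0) = 1` for `d ≥ 1`, `G(d,s) = F(d-s,s)` for `d ≥ 1`, `s ≥ 1`, and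
`F(d,s) = ∑_{i=0}^{s} C(s,i)·G(d,i)` for `d ≥ 1`, then `F(d,s) = C(d+s-1,s)` for `d ≥ 1`. -/
theorem F_eq_choose (F G : ℤ × ℕ → ℕ)
    (hF0 : ∀ r : ℤ, r ≤ 0 → ∀ s : ℕ, F (r, s) = 0)
    (hG0 : ∀ d : ℤ, 1 ≤ d → G (d, 0) = 1)
    (hGF : ∀ d : ℤ, 1 ≤ d → ∀ s : ℕ, 1 ≤ s → G (d, s) = F (d - (s : ℤ), s))
    (hFG : ∀ d : ℤ, 1 ≤ d → ∀ s : ℕ,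
      F (d, s) = ∑ i ∈ Finset.range (s + 1), Nat.choose s i * G (d, i)) :
    ∀ d : ℤ, 1 ≤ d → ∀ s : ℕ, F (d, s) = Nat.choose (d + (s : ℤ) - 1).toNat s := by
  have key : ∀ n s : ℕ, F ((n : ℤ) + 1, s) = (n + s).choose s := by
    intro n
    induction n using Nat.strong_induction_on with
    | _ n ih =>
      intro s
      rw [hFG _ (by omega), ← Nat.sum_range_choose_mul_choose]
      refine Finset.sum_congr rfl fun i _ => ?_
      congr 1
      rcases Nat.eq_zero_or_pos i with rfl | hi
      · rw [hG0 _ (by omega), Nat.choose_zero_right]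
      · rw [hGF _ (by omega) i hi]
        rcases Nat.lt_or_ge n i with hni | hin
        · rw [hF0 _ (by omega), Nat.choose_eq_zero_of_lt hni]
        · have hd : (n : ℤ) + 1 - i = ((n - i : ℕ) : ℤ) + 1 := by omega
          rw [hd, ih (n - i) (by omega), Nat.sub_add_cancel hin]
  intro d hd s
  obtain ⟨n, rfl⟩ : ∃ n : ℕ, d = (n : ℤ) + 1 := ⟨(d - 1).toNat, by omega⟩
  rw [key]
  congr 1
  omega
end

section
/- Let m ≥ 1, k ≤ m, and d_1,…,d_k ≥ 1 be integers. For every natural number n, the dimension over ℂ of the degree-n homogeneous component of the quotient ring ℂ[z_1,…,z_m]/(z_1^{d_1},…,z_k^{d_k}) equals ∑_{I⊆{1,…,k}} (−1)^{|I|} C(n − ∑_{i∈I} d_i + m − 1, m − 1), where a summand is taken to be 0 whenever n < ∑_{i∈I} d_i. -/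
open MvPolynomial

/-- The degree-`n` homogeneous component of the quotient of `ℂ[z_1,…,z_m]` by an ideal `I`:
the image of the degree-`n` component of the polynomial ring under the quotient map. -/
noncomputable def quotComponent {m : ℕ} (I : Ideal (MvPolynomial (Fin m) ℂ)) (n : ℕ) :
    Submodule ℂ (MvPolynomial (Fin m) ℂ ⧸ I) :=
  Submodule.map (Ideal.Quotient.mkₐ ℂ I).toLinearMap (homogeneousSubmodule (Fin m) ℂ n)

/-- The degree-`n` component of the quotient by a monomial ideal has dimension the number of
degree-`n` exponents that no generating exponent divides. -/
theorem finrank_quotComponent_span_monomial {m : ℕ} (S : Set (Fin m →₀ ℕ)) (n : ℕ)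
    [DecidablePred fun a : Fin m →₀ ℕ => ∀ s ∈ S, ¬ s ≤ a] :
    Module.finrank ℂ
        (quotComponent (Ideal.span ((fun s => monomial s (1 : ℂ)) '' S)) n)
      = ((Finset.univ.finsuppAntidiag n).filter fun a : Fin m →₀ ℕ => ∀ s ∈ S, ¬ s ≤ a).card := by
  set I := Ideal.span ((fun s => monomial s (1 : ℂ)) '' S) with hI
  set T := (Finset.univ.finsuppAntidiag n).filter fun a : Fin m →₀ ℕ => ∀ s ∈ S, ¬ s ≤ a
    with hT
  have mem_T (a : Fin m →₀ ℕ) : a ∈ T ↔ a.degree = n ∧ ∀ s ∈ S, ¬ s ≤ a := by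
    simp [hT, Finsupp.degree_eq_sum]
  let H := homogeneousSubmodule (Fin m) ℂ n
  let f : H →ₗ[ℂ] (MvPolynomial (Fin m) ℂ ⧸ I) :=
    (Ideal.Quotient.mkₐ ℂ I).toLinearMap ∘ₗ H.subtype
  let g : H →ₗ[ℂ] (T → ℂ) := (LinearMap.pi fun t : T => lcoeff ℂ t.1) ∘ₗ H.subtype
  have range_f : LinearMap.range f = quotComponent I n := by
    rw [LinearMap.range_comp, Submodule.range_subtype]
    rfl
  have range_g : LinearMap.range g = ⊤ := by
    rw [LinearMap.range_eq_top]
    intro c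
    refine ⟨⟨∑ t : T, monomial t.1 (c t), Submodule.sum_mem _ fun t _ =>
      isHomogeneous_monomial _ ((mem_T _).1 t.2).1⟩, ?_⟩
    ext t
    simp [g, coeff_monomial]
  have ker_eq : LinearMap.ker f = LinearMap.ker g := by
    ext ⟨p, hp⟩
    have h1 : (⟨p, hp⟩ : H) ∈ LinearMap.ker f ↔ p ∈ I := Ideal.Quotient.eq_zero_iff_mem
    rw [h1, hI, mem_ideal_span_monomial_image, LinearMap.mem_ker, funext_iff]
    constructor
    · rintro h ⟨t, ht⟩
      by_contra hne
      obtain ⟨s, hs, hle⟩ := h t (mem_support_iff.2 hne)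
      exact ((mem_T t).1 ht).2 s hs hle
    · intro h a ha
      by_contra! hcon
      have hdeg : a.degree = n := by
        rw [Finsupp.degree_eq_weight_one]
        exact hp (mem_support_iff.1 ha)
      exact mem_support_iff.1 ha (h ⟨a, (mem_T a).2 ⟨hdeg, hcon⟩⟩)
  have e := f.quotKerEquivRange.symm.trans
    ((Submodule.quotEquivOfEq _ _ ker_eq).trans g.quotKerEquivRange)
  rw [← range_f, e.finrank_eq, range_g, finrank_top, Module.finrank_fintype_fun_eq_card,
    Fintype.card_coe]

/-- The number of exponents of degree `n` in `m ≥ 1` variables divisible by a given one. -/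
theorem card_finsuppAntidiag_filter_le {m : ℕ} (hm : 1 ≤ m) (e : Fin m →₀ ℕ) (n : ℕ)
    [DecidablePred fun a : Fin m →₀ ℕ => e ≤ a] :
    ((Finset.univ.finsuppAntidiag n).filter fun a : Fin m →₀ ℕ => e ≤ a).card
      = if e.degree ≤ n then (n - e.degree + m - 1).choose (m - 1) else 0 := by
  split_ifs with h
  · have key : ((Finset.univ.finsuppAntidiag n).filter fun a : Fin m →₀ ℕ => e ≤ a)
        = (Finset.univ.finsuppAntidiag (n - e.degree)).map (addRightEmbedding e) := by
      ext a
      simp only [Finset.mem_filter, Finset.mem_finsuppAntidiag, Finset.subset_univ, and_true,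
        Finset.mem_map, addRightEmbedding_apply, ← Finsupp.degree_eq_sum]
      constructor
      · rintro ⟨ha, hle⟩
        refine ⟨a - e, ?_, tsub_add_cancel_of_le hle⟩
        have := congrArg Finsupp.degree (tsub_add_cancel_of_le hle)
        rw [map_add] at this
        omega
      · rintro ⟨b, hb, rfl⟩
        exact ⟨by rw [map_add]; omega, le_add_self⟩
    rw [key, Finset.card_map, Finset.card_finsuppAntidiag_nat_eq_choose, Finset.card_univ,
      Fintype.card_fin, add_comm m]
    exact Nat.choose_symm_of_eq_add (by omega)
  · rw [Finset.card_eq_zero, Finset.filter_eq_empty_iff]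
    intro a ha hle
    rw [Finset.mem_finsuppAntidiag, ← Finsupp.degree_eq_sum] at ha
    exact h (ha.1 ▸ Finsupp.degree_mono hle)

theorem sum_single_le_iff {ι σ : Type*} {c : ι → σ} (hc : Function.Injective c) (d : ι → ℕ)
    (I : Finset ι) (a : σ →₀ ℕ) :
    ∑ i ∈ I, Finsupp.single (c i) (d i) ≤ a ↔ ∀ i ∈ I, Finsupp.single (c i) (d i) ≤ a := by
  classical
  refine ⟨fun h i hi => (Finset.single_le_sum (f := fun i => Finsupp.single (c i) (d i))
    (fun _ _ => zero_le) hi).trans h, fun h j => ?_⟩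
  rw [Finsupp.finsetSum_apply]
  by_cases hj : ∃ i ∈ I, c i = j
  · obtain ⟨i, hi, rfl⟩ := hj
    rw [Finset.sum_eq_single_of_mem i hi fun b _ hb =>
      Finsupp.single_eq_of_ne' (hc.ne hb)]
    exact h i hi (c i)
  · push Not at hj
    rw [Finset.sum_eq_zero fun i hi => Finsupp.single_eq_of_ne' (hj i hi)]
    exact zero_le

/-- Inclusion–exclusion for the number of elements of a finset satisfying none of a finite
family of predicates. -/
theorem card_filter_forall_not {α ι : Type*} [Fintype ι] (A : Finset α) (P : ι → α → Prop)
    [∀ i, DecidablePred (P i)] [DecidablePred fun a => ∀ i, ¬ P i a] :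
    ((A.filter fun a => ∀ i, ¬ P i a).card : ℤ)
      = ∑ I ∈ (Finset.univ : Finset ι).powerset,
          (-1 : ℤ) ^ I.card * ((A.filter fun a => ∀ i ∈ I, P i a).card : ℤ) := by
  have indicator (a : α) : (if ∀ i, ¬ P i a then (1 : ℤ) else 0)
      = ∑ I ∈ (Finset.univ : Finset ι).powerset,
          (-1 : ℤ) ^ I.card * (if ∀ i ∈ I, P i a then 1 else 0) := by
    have h := Finset.prod_one_add (f := fun i => -(if P i a then (1 : ℤ) else 0)) Finset.univ
    simp only [Finset.prod_neg, Finset.prod_ite_zero, Finset.prod_const_one] at h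
    rw [← h]
    have h' (i : ι) : 1 + -(if P i a then (1 : ℤ) else 0) = if ¬ P i a then 1 else 0 := by
      split_ifs <;> simp_all
    simp only [h', Finset.prod_ite_zero, Finset.prod_const_one, Finset.mem_univ, true_imp_iff]
  simp only [Finset.card_filter, Nat.cast_sum, Nat.cast_ite, Nat.cast_one, Nat.cast_zero,
    indicator, Finset.mul_sum]
  exact Finset.sum_comm

/-- The dimension of the degree-`n` component of `ℂ[z_1,…,z_m]/(z_1^{d_1},…,z_k^{d_k})`
equals `∑_{I ⊆ {1,…,k}} (-1)^{|I|} C(n - ∑_{i∈I} d_i + m - 1, m - 1)`, where a summand is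
`0` whenever `n < ∑_{i∈I} d_i`. -/
theorem finrank_quot_powers_monomial_ideal (m k : ℕ) (hm : 1 ≤ m) (hk : k ≤ m)
    (d : Fin k → ℕ) (hd : ∀ i, 1 ≤ d i) (n : ℕ) :
    (Module.finrank ℂ
        (quotComponent (Ideal.span (Set.range fun i : Fin k =>
          (X (Fin.castLE hk i) : MvPolynomial (Fin m) ℂ) ^ d i)) n) : ℤ)
      = ∑ I ∈ (Finset.univ : Finset (Fin k)).powerset,
          (-1 : ℤ) ^ I.card *
            (if (∑ i ∈ I, d i) ≤ n then (Nat.choose (n - (∑ i ∈ I, d i) + m - 1) (m - 1) : ℤ)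
             else 0) := by
  classical
  have hgen : (Set.range fun i : Fin k =>
      (X (Fin.castLE hk i) : MvPolynomial (Fin m) ℂ) ^ d i)
      = (fun s => monomial s (1 : ℂ)) ''
          Set.range fun i : Fin k => Finsupp.single (Fin.castLE hk i) (d i) := by
    rw [← Set.range_comp]
    simp only [Function.comp_def, X_pow_eq_monomial]
  rw [hgen, finrank_quotComponent_span_monomial]
  simp only [Set.forall_mem_range]
  rw [card_filter_forall_not _ fun (i : Fin k) a => Finsupp.single (Fin.castLE hk i) (d i) ≤ a]
  simp only [← sum_single_le_iff (Fin.castLE_injective hk), card_finsuppAntidiag_filter_le hm,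
    map_sum, Finsupp.degree_single, Nat.cast_ite, Nat.cast_zero]
end

section
/- In the bigraded setup below, assume in addition that d_1 ≥ 2, that d_1 ≤ d_j for all j, and that f_1 = z_1^{d_1} + z_2^{d_1} + ⋯ + z_{N+k+1}^{d_1}. Then the images of the N+k+1 partial derivatives ∂F/∂z_1, …, ∂F/∂z_{N+k+1} (each of bidegree (1,−1)) in R′ are linearly independent over ℂ. -/
open MvPolynomial

noncomputable section

/-- The polynomial ring `S = ℂ[z_1,…,z_{N+k+1}, w_1,…,w_k]`. -/
abbrev SRing (N k : ℕ) : Type := MvPolynomial (Fin (N + k + 1) ⊕ Fin k) ℂ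

/-- The bigrading on `S`: `deg z_s = (0,1)` and `deg w_j = (1, -d_j)`. -/
def wt (N k : ℕ) (d : Fin k → ℕ) : Fin (N + k + 1) ⊕ Fin k → ℤ × ℤ :=
  Sum.elim (fun _ => ((0 : ℤ), (1 : ℤ))) (fun j => ((1 : ℤ), -(d j : ℤ)))

/-- `F = w_1 f_1 + ⋯ + w_k f_k ∈ S`. -/
def bigF (N k : ℕ) (f : Fin k → MvPolynomial (Fin (N + k + 1)) ℂ) : SRing N k :=
  ∑ j : Fin k, X (Sum.inr j) * rename Sum.inl (f j)

/-- The ideal `J(F)` generated by all the partial derivatives of `F`. -/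
def Jfull (N k : ℕ) (f : Fin k → MvPolynomial (Fin (N + k + 1)) ℂ) : Ideal (SRing N k) :=
  Ideal.span (Set.range fun v : Fin (N + k + 1) ⊕ Fin k => pderiv v (bigF N k f))

/-- The ideal `J'(F)` generated by `∂F/∂w_1, …, ∂F/∂w_k` alone. -/
def Jprime (N k : ℕ) (f : Fin k → MvPolynomial (Fin (N + k + 1)) ℂ) : Ideal (SRing N k) :=
  Ideal.span (Set.range fun j : Fin k => pderiv (Sum.inr j) (bigF N k f))

lemma Jprime_le_Jfull (N k : ℕ) (f : Fin k → MvPolynomial (Fin (N + k + 1)) ℂ) :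
    Jprime N k f ≤ Jfull N k f :=
  Ideal.span_mono (by rintro x ⟨j, rfl⟩; exact ⟨Sum.inr j, rfl⟩)

/-- Every element of an ideal generated by homogeneous polynomials of degrees at least `n` has
no monomials of degree less than `n`. -/
lemma coeff_eq_zero_of_mem_span_isHomogeneous {σ ι R : Type*} [CommSemiring R] {n : ℕ}
    {d : ι → ℕ} {f : ι → MvPolynomial σ R} (hf : ∀ j, (f j).IsHomogeneous (d j))
    (hn : ∀ j, n ≤ d j) {p : MvPolynomial σ R} (hp : p ∈ Ideal.span (Set.range f))
    {m : σ →₀ ℕ} (hm : m.degree < n) : coeff m p = 0 := by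
  classical
  induction hp using Submodule.span_induction generalizing m with
  | mem x hx =>
    obtain ⟨j, rfl⟩ := hx
    exact (hf j).coeff_eq_zero (hm.trans_le (hn j)).ne
  | zero => simp
  | add x y _ _ hx hy => rw [coeff_add, hx hm, hy hm, add_zero]
  | smul a x _ hx =>
    rw [smul_eq_mul, coeff_mul]
    refine Finset.sum_eq_zero fun q hq => ?_
    rw [Finset.HasAntidiagonal.mem_antidiagonal] at hq
    rw [hx, mul_zero]
    rw [← hq, map_add] at hm
    omega

/-- The substitution `w_i ↦ 1`, `w_j ↦ 0` for `j ≠ i`, fixing every `z_s`. -/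
def specializeW (N k : ℕ) (i : Fin k) : SRing N k →ₐ[ℂ] MvPolynomial (Fin (N + k + 1)) ℂ :=
  aeval (Sum.elim X (Pi.single i 1))

lemma specializeW_rename (N k : ℕ) (i : Fin k) (p : MvPolynomial (Fin (N + k + 1)) ℂ) :
    specializeW N k i (rename Sum.inl p) = p := by
  rw [specializeW, aeval_rename, Sum.elim_comp_inl, aeval_X_left_apply]

lemma pderiv_inr_bigF (N k : ℕ) (f : Fin k → MvPolynomial (Fin (N + k + 1)) ℂ) (j : Fin k) :
    pderiv (Sum.inr j) (bigF N k f) = rename Sum.inl (f j) := by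
  classical
  have h (i : Fin k) : pderiv (Sum.inr j : Fin (N + k + 1) ⊕ Fin k)
      (rename Sum.inl (f i)) = 0 := by
    refine pderiv_eq_zero_of_notMem_vars fun hj => ?_
    have := vars_rename Sum.inl (f i) hj
    simp at this
  simp [bigF, h, pderiv_X, Pi.single_apply, Sum.inr.injEq]

lemma pderiv_inl_bigF (N k : ℕ) (f : Fin k → MvPolynomial (Fin (N + k + 1)) ℂ)
    (s : Fin (N + k + 1)) :
    pderiv (Sum.inl s) (bigF N k f) =
      ∑ j, X (Sum.inr j) * rename Sum.inl (pderiv s (f j)) := by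
  simp [bigF, pderiv_rename Sum.inl_injective, pderiv_X]

lemma specializeW_pderiv_inl_bigF (N k : ℕ) (f : Fin k → MvPolynomial (Fin (N + k + 1)) ℂ)
    (i : Fin k) (s : Fin (N + k + 1)) :
    specializeW N k i (pderiv (Sum.inl s) (bigF N k f)) = pderiv s (f i) := by
  classical
  have h (j : Fin k) : specializeW N k i (X (Sum.inr j)) = if j = i then 1 else 0 := by
    simp [specializeW, Pi.single_apply]
  simp [pderiv_inl_bigF, specializeW_rename, h]

lemma specializeW_mem_span_range (N k : ℕ) (f : Fin k → MvPolynomial (Fin (N + k + 1)) ℂ)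
    (i : Fin k) {p : SRing N k} (hp : p ∈ Jprime N k f) :
    specializeW N k i p ∈ Ideal.span (Set.range f) := by
  have h := Ideal.mem_map_of_mem (specializeW N k i) hp
  rw [Jprime, Ideal.map_span, ← Set.range_comp] at h
  convert h using 3
  ext1 j
  simp only [Function.comp_apply, pderiv_inr_bigF, specializeW_rename]

/-- The coefficient of `z_s ^ (n - 1)` in `∂/∂z_t` of the Fermat polynomial of degree `n`. -/
lemma coeff_pderiv_sum_X_pow {σ R : Type*} [Fintype σ] [DecidableEq σ] [CommSemiring R] {n : ℕ}
    (hn : 2 ≤ n) (s t : σ) :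
    coeff (Finsupp.single s (n - 1)) (pderiv t (∑ u, (X u : MvPolynomial σ R) ^ n)) =
      if t = s then (n : R) else 0 := by
  have h : pderiv t (∑ u, (X u : MvPolynomial σ R) ^ n) = C (n : R) * X t ^ (n - 1) := by
    rw [map_sum, Finset.sum_eq_single t]
    · simp
    · intro u _ hu
      simp [pderiv_X_of_ne hu]
    · simp
  rw [h, coeff_C_mul, coeff_X_pow]
  have : Finsupp.single t (n - 1) = Finsupp.single s (n - 1) ↔ t = s :=
    Finsupp.single_left_inj (by omega)
  simp only [this, mul_ite, mul_one, mul_zero]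

/-- **Key step in Lemma 3.4.** If `d_1 ≥ 2` is minimal among the degrees and
`f_1 = z_1^{d_1} + ⋯ + z_{N+k+1}^{d_1}`, then the images of the `N+k+1` partial
derivatives `∂F/∂z_s` (of bidegree `(1,-1)`) in `R' = S/J'(F)` are linearly
independent over `ℂ`. -/
theorem pderiv_linearIndependent_in_Rprime (N k : ℕ) (hN : 1 ≤ N) (hk : 1 ≤ k)
    (d : Fin k → ℕ) (hd : ∀ j, 1 ≤ d j)
    (f : Fin k → MvPolynomial (Fin (N + k + 1)) ℂ)
    (hfhom : ∀ j, (f j).IsHomogeneous (d j))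
    (hd1 : 2 ≤ d ⟨0, hk⟩) (hmin : ∀ j, d ⟨0, hk⟩ ≤ d j)
    (hf1 : f ⟨0, hk⟩ = ∑ s : Fin (N + k + 1), (X s : MvPolynomial (Fin (N + k + 1)) ℂ) ^ d ⟨0, hk⟩) :
    LinearIndependent ℂ (fun s : Fin (N + k + 1) =>
      Ideal.Quotient.mk (Jprime N k f) (pderiv (Sum.inl s) (bigF N k f))) := by
  rw [Fintype.linearIndependent_iff]
  intro c hc s
  have hmem : ∑ t, c t • pderiv (Sum.inl t) (bigF N k f) ∈ Jprime N k f := by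
    rw [← Ideal.Quotient.eq_zero_iff_mem, ← hc, map_sum]
    rfl
  have hspan := specializeW_mem_span_range N k f ⟨0, hk⟩ hmem
  have hdeg : (Finsupp.single s (d ⟨0, hk⟩ - 1)).degree < d ⟨0, hk⟩ := by
    rw [Finsupp.degree_single]
    omega
  have hcoeff := coeff_eq_zero_of_mem_span_isHomogeneous hfhom hmin hspan hdeg
  simp only [map_sum (specializeW N k _), map_smul, specializeW_pderiv_inl_bigF, hf1, coeff_sum,
    coeff_smul, coeff_pderiv_sum_X_pow hd1, smul_eq_mul, mul_ite, mul_zero, Finset.sum_ite_eq',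
    Finset.mem_univ, if_true] at hcoeff
  have hne : (d ⟨0, hk⟩ : ℂ) ≠ 0 := by
    exact_mod_cast (show d ⟨0, hk⟩ ≠ 0 by omega)
  exact (mul_eq_zero.mp hcoeff).resolve_right hne
end
end

section
/- In the bigraded setup below, assume in addition that f_1,…,f_k form a regular sequence in ℂ[z_1,…,z_{N+k+1}], and set i(X) = N+k+1 − (d_1+…+d_k). If i(X) ≥ 1, then dim_ℂ R′_{1,−i(X)} = ∑_{j=1}^{k} ∑_{I⊆{1,…,k}} (−1)^{k−|I|} C((∑_{s∈I} d_s) + d_j − 1, N+k). -/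
open MvPolynomial

noncomputable section

/-- The bidegree-`(p,q)` component of `S`. -/
def Scomp (N k : ℕ) (d : Fin k → ℕ) (p q : ℤ) : Submodule ℂ (SRing N k) :=
  weightedHomogeneousSubmodule ℂ (wt N k d) (p, q)

/-- The bidegree-`(p,q)` component of `R' = S/J'(F)`. -/
def R'comp (N k : ℕ) (d : Fin k → ℕ) (f : Fin k → MvPolynomial (Fin (N + k + 1)) ℂ)
    (p q : ℤ) : Submodule ℂ (SRing N k ⧸ Jprime N k f) :=
  Submodule.map (Ideal.Quotient.mkₐ ℂ (Jprime N k f)).toLinearMap (Scomp N k d p q)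

/-- `f 0, …, f (k-1)` is a regular sequence: each `f i` is a nonzerodivisor modulo the
ideal generated by the previous ones. -/
def IsRegularSeq {m k : ℕ} (f : Fin k → MvPolynomial (Fin m) ℂ) : Prop :=
  ∀ i : Fin k, ∀ p : MvPolynomial (Fin m) ℂ,
    f i * p ∈ Ideal.span (f '' {j : Fin k | j < i}) →
      p ∈ Ideal.span (f '' {j : Fin k | j < i})

section HilbertSeries

variable {σ K : Type*} [Field K]

attribute [local instance] MvPolynomial.gradedAlgebra

/-- The image in `K[σ] ⧸ I` of the forms of degree `e`. -/
def quotientPart (I : Ideal (MvPolynomial σ K)) (e : ℕ) : Submodule K (MvPolynomial σ K ⧸ I) :=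
  (homogeneousSubmodule σ K e).map (Ideal.Quotient.mkₐ K I).toLinearMap

/-- The generating function of the dimensions of the graded pieces of `K[σ] ⧸ I`. -/
def quotientHilbertSeries (I : Ideal (MvPolynomial σ K)) : PowerSeries ℤ :=
  PowerSeries.mk fun e => (Module.finrank K (quotientPart I e) : ℤ)

instance [Finite σ] (e : ℕ) : Module.Finite K (homogeneousSubmodule σ K e) :=
  Module.Finite.iff_fg.2 (homogeneousSubmodule_fg σ K e)

instance [Finite σ] (I : Ideal (MvPolynomial σ K)) (e : ℕ) :
    Module.Finite K (quotientPart I e) :=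
  inferInstanceAs (Module.Finite K ((homogeneousSubmodule σ K e).map _))

lemma homogeneousComponent_mul_of_isHomogeneous {g : MvPolynomial σ K} {d : ℕ}
    (hg : g.IsHomogeneous d) (p : MvPolynomial σ K) (e : ℕ) :
    homogeneousComponent e (g * p) =
      if d ≤ e then g * homogeneousComponent (e - d) p else 0 := by
  have hp := sum_homogeneousComponent p
  conv_lhs => rw [← hp, Finset.mul_sum, map_sum]
  have h (i : ℕ) : homogeneousComponent e (g * homogeneousComponent i p) =
      if e = d + i then g * homogeneousComponent i p else 0 :=
    homogeneousComponent_of_mem (hg.mul (homogeneousComponent_isHomogeneous i p))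
  simp_rw [h]
  split_ifs with hde
  · obtain ⟨c, rfl⟩ := Nat.exists_eq_add_of_le hde
    simp only [Nat.add_left_cancel_iff, Finset.sum_ite_eq, Finset.mem_range,
      Nat.add_sub_cancel_left]
    split_ifs with hc
    · rfl
    · rw [homogeneousComponent_eq_zero _ _ (by omega), mul_zero]
  · exact Finset.sum_eq_zero fun i _ => if_neg (by omega)

lemma map_factor_quotientPart {I J : Ideal (MvPolynomial σ K)} (h : I ≤ J) (e : ℕ) :
    (quotientPart I e).map (Ideal.Quotient.factorₐ K h).toLinearMap = quotientPart J e := by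
  rw [quotientPart, quotientPart, ← Submodule.map_comp]
  rfl

lemma quotientPart_inf_ker_factor {I : Ideal (MvPolynomial σ K)}
    (hI : I.IsHomogeneous (homogeneousSubmodule σ K)) {g : MvPolynomial σ K} {d : ℕ}
    (hg : g.IsHomogeneous d) (e : ℕ) :
    quotientPart I e ⊓ LinearMap.ker
        (Ideal.Quotient.factorₐ K (le_sup_left : I ≤ I ⊔ Ideal.span {g})).toLinearMap =
      if d ≤ e then (quotientPart I (e - d)).map
        (LinearMap.mulLeft K (Ideal.Quotient.mkₐ K I g)) else ⊥ := by
  apply le_antisymm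
  · rintro _ ⟨⟨v, hv, rfl⟩, hker⟩
    replace hker : v ∈ I ⊔ Ideal.span {g} := by
      rw [← Ideal.Quotient.eq_zero_iff_mem]
      simpa using hker
    obtain ⟨a, ha, b, hb, rfl⟩ := Submodule.mem_sup.1 hker
    obtain ⟨c, rfl⟩ := Ideal.mem_span_singleton'.1 hb
    have ha' := homogeneousComponent_mem_of_mem hI ha e
    have hv' := homogeneousComponent_of_mem (m := e) hv
    rw [if_pos rfl, map_add, mul_comm, homogeneousComponent_mul_of_isHomogeneous hg] at hv'
    have key : Ideal.Quotient.mk I (homogeneousComponent e a) = 0 :=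
      Ideal.Quotient.eq_zero_iff_mem.2 ha'
    rw [mul_comm c, ← hv']
    split_ifs at hv' ⊢ with hde
    · refine ⟨_, ⟨_, homogeneousComponent_mem (e - d) c, rfl⟩, ?_⟩
      simp [key]
    · simp [key]
  · split_ifs with hde
    · rintro _ ⟨_, ⟨v, hv, rfl⟩, rfl⟩
      refine ⟨⟨g * v, ?_, by simp⟩, ?_⟩
      · have := hg.mul hv
        rwa [Nat.add_sub_cancel' hde] at this
      · have : g * v ∈ I ⊔ Ideal.span {g} :=
          Ideal.mul_mem_right _ _ (Ideal.mem_sup_right (Ideal.mem_span_singleton_self g))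
        rw [← Ideal.Quotient.eq_zero_iff_mem] at this
        simpa using this
    · exact bot_le

lemma quotientHilbertSeries_sup_span_singleton [Finite σ] {I : Ideal (MvPolynomial σ K)}
    (hI : I.IsHomogeneous (homogeneousSubmodule σ K)) {g : MvPolynomial σ K} {d : ℕ}
    (hg : g.IsHomogeneous d) (hreg : ∀ p, g * p ∈ I → p ∈ I) :
    quotientHilbertSeries (I ⊔ Ideal.span {g}) =
      (1 - PowerSeries.X ^ d) * quotientHilbertSeries I := by
  ext e
  set φ := (Ideal.Quotient.factorₐ K (le_sup_left : I ≤ I ⊔ Ideal.span {g})).toLinearMap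
  have hrank := LinearMap.finrank_range_add_finrank_ker (φ.domRestrict (quotientPart I e))
  have hker : Module.finrank K (LinearMap.ker (φ.domRestrict (quotientPart I e))) =
      Module.finrank K ↥(quotientPart I e ⊓ LinearMap.ker φ) := by
    rw [LinearMap.ker_domRestrict, ← Submodule.finrank_map_subtype_eq,
      Submodule.map_comap_subtype]
  rw [LinearMap.range_domRestrict, hker, map_factor_quotientPart,
    quotientPart_inf_ker_factor hI hg] at hrank
  have hinj : Function.Injective (LinearMap.mulLeft K (Ideal.Quotient.mkₐ K I g)) := by
    rw [injective_iff_map_eq_zero]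
    intro x hx
    obtain ⟨p, rfl⟩ := Ideal.Quotient.mk_surjective x
    refine Ideal.Quotient.eq_zero_iff_mem.2 (hreg p (Ideal.Quotient.eq_zero_iff_mem.1 ?_))
    simpa using hx
  simp only [quotientHilbertSeries, sub_mul, one_mul, map_sub, PowerSeries.coeff_mk,
    PowerSeries.coeff_X_pow_mul']
  by_cases hde : d ≤ e
  · rw [if_pos hde, ← (Submodule.equivMapOfInjective _ hinj _).finrank_eq] at hrank
    rw [if_pos hde]
    omega
  · rw [if_neg hde, finrank_bot] at hrank
    rw [if_neg hde]
    omega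

lemma finrank_homogeneousSubmodule [Fintype σ] (e : ℕ) :
    Module.finrank K (homogeneousSubmodule σ K e) = (Fintype.card σ).multichoose e := by
  classical
  have hset : {m : σ →₀ ℕ | m.degree = e} = (Finset.univ.finsuppAntidiag e : Finset (σ →₀ ℕ)) := by
    ext m
    simp [Finset.mem_finsuppAntidiag, Finsupp.degree_eq_sum]
  rw [homogeneousSubmodule_eq_finsupp_supported, hset,
    (AddMonoidAlgebra.supportedEquivFinsupp _).finrank_eq, Module.finrank_finsupp_self,
    Fintype.card_eq_nat_card, Nat.card_coe_set_eq, Set.ncard_coe_finset,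
    Finset.card_finsuppAntidiag_nat_eq_multichoose, Finset.card_univ]

lemma quotientHilbertSeries_bot [Fintype σ] :
    quotientHilbertSeries (⊥ : Ideal (MvPolynomial σ K)) =
      PowerSeries.mk fun e => ((Fintype.card σ).multichoose e : ℤ) := by
  ext e
  have hinj : Function.Injective
      (Ideal.Quotient.mkₐ K (⊥ : Ideal (MvPolynomial σ K))).toLinearMap := by
    rw [injective_iff_map_eq_zero]
    intro x hx
    exact Ideal.Quotient.eq_zero_iff_mem.1 hx
  rw [quotientHilbertSeries, PowerSeries.coeff_mk, PowerSeries.coeff_mk, quotientPart,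
    ← finrank_homogeneousSubmodule (K := K),
    (Submodule.equivMapOfInjective _ hinj _).finrank_eq]

lemma quotientHilbertSeries_span_range [Fintype σ] {k : ℕ} (d : Fin k → ℕ)
    (f : Fin k → MvPolynomial σ K) (hf : ∀ j, (f j).IsHomogeneous (d j))
    (hreg : ∀ i : Fin k, ∀ p, f i * p ∈ Ideal.span (f '' {j | j < i}) →
      p ∈ Ideal.span (f '' {j | j < i})) :
    quotientHilbertSeries (Ideal.span (Set.range f)) =
      (∏ j, (1 - PowerSeries.X ^ d j)) *
        PowerSeries.mk fun e => ((Fintype.card σ).multichoose e : ℤ) := by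
  have key (m : ℕ) (hm : m ≤ k) :
      quotientHilbertSeries (Ideal.span (f '' {j | j.val < m})) =
        (∏ j with j.val < m, (1 - PowerSeries.X ^ d j)) *
          PowerSeries.mk fun e => ((Fintype.card σ).multichoose e : ℤ) := by
    induction m with
    | zero => simp [← quotientHilbertSeries_bot (σ := σ) (K := K)]
    | succ m ih =>
      let i : Fin k := ⟨m, hm⟩
      have hset : {j : Fin k | j.val < m + 1} = insert i {j | j.val < m} := by
        ext j
        simp [i, Fin.ext_iff]
        omega
      have hfin : ({j : Fin k | j.val < m + 1} : Finset (Fin k)) =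
          insert i ({j | j.val < m} : Finset (Fin k)) := by
        ext j
        simp [i, Fin.ext_iff]
        omega
      have hhom : (Ideal.span (f '' {j | j.val < m})).IsHomogeneous
          (homogeneousSubmodule σ K) := by
        refine Ideal.homogeneous_span _ _ ?_
        rintro _ ⟨j, -, rfl⟩
        exact ⟨d j, hf j⟩
      rw [hset, hfin, Set.image_insert_eq, Ideal.span_insert, sup_comm,
        quotientHilbertSeries_sup_span_singleton hhom (hf i) (hreg i), ih (by omega),
        Finset.prod_insert (by simp [i]), mul_assoc]
  have := key k le_rfl
  simpa using this

end HilbertSeries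

section HilbertCoeff

lemma coeff_prod_one_sub_X_pow_mul {ι : Type*} [Fintype ι] [DecidableEq ι] (d : ι → ℕ)
    {n e i : ℕ} (he : 1 ≤ e) (hi : i + ∑ s, d s = n + 1) :
    (if i ≤ e then PowerSeries.coeff (e - i) ((∏ j, (1 - PowerSeries.X ^ d j)) *
        PowerSeries.mk fun e => ((n + 1).multichoose e : ℤ)) else 0) =
      ∑ I ∈ (Finset.univ : Finset ι).powerset,
        (-1 : ℤ) ^ (Fintype.card ι - I.card) * Nat.choose ((∑ s ∈ I, d s) + e - 1) n := by
  have hterm (t : Finset ι) :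
      (if i ≤ e then PowerSeries.coeff (e - i) (PowerSeries.X ^ (∑ s ∈ t, d s) *
        PowerSeries.mk fun e => ((n + 1).multichoose e : ℤ)) else 0) =
      (Nat.choose ((∑ s ∈ tᶜ, d s) + e - 1) n : ℤ) := by
    have hsum := Finset.sum_add_sum_compl t d
    rw [PowerSeries.coeff_X_pow_mul', ← ite_and]
    split_ifs with h
    · have heq : (∑ s ∈ tᶜ, d s) + e - 1 = n + 1 + (e - i - ∑ s ∈ t, d s) - 1 := by omega
      rw [PowerSeries.coeff_mk, Nat.multichoose_eq, heq,
        Nat.choose_symm_of_eq_add (a := n) (b := e - i - ∑ s ∈ t, d s) (by omega)]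
    · rw [Nat.choose_eq_zero_of_lt (by omega), Nat.cast_zero]
  have hexp : (∏ j, (1 - PowerSeries.X ^ d j) : PowerSeries ℤ) =
      ∑ t ∈ Finset.univ.powerset, (-1) ^ t.card * PowerSeries.X ^ (∑ s ∈ t, d s) := by
    simp [Finset.prod_sub, Finset.prod_pow_eq_pow_sum]
  calc _ = ∑ t ∈ (Finset.univ : Finset ι).powerset,
        (-1 : ℤ) ^ t.card * Nat.choose ((∑ s ∈ tᶜ, d s) + e - 1) n := by
        simp_rw [← hterm]
        rw [hexp, Finset.sum_mul, map_sum]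
        split_ifs with h
        · refine Finset.sum_congr rfl fun t _ => ?_
          have : ((-1) ^ t.card : PowerSeries ℤ) = PowerSeries.C ((-1) ^ t.card) := by simp
          rw [this, mul_assoc, PowerSeries.coeff_C_mul]
        · simp
    _ = _ := by
        refine Finset.sum_nbij' compl compl ?_ ?_ ?_ ?_ ?_
        · simp
        · simp
        · simp
        · simp
        · intro t _
          rw [Finset.card_compl, Nat.sub_sub_self (Finset.card_le_univ t)]

end HilbertCoeff

section Bigraded

variable {N k : ℕ} {d : Fin k → ℕ} {f : Fin k → MvPolynomial (Fin (N + k + 1)) ℂ}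

lemma pderiv_inr_rename_inl (j : Fin k) (p : MvPolynomial (Fin (N + k + 1)) ℂ) :
    pderiv (Sum.inr j) (rename (Sum.inl : _ → Fin (N + k + 1) ⊕ Fin k) p) = 0 := by
  classical
  refine pderiv_eq_zero_of_notMem_vars fun hmem => ?_
  simpa using vars_rename _ _ hmem

lemma Jprime_eq_span : Jprime N k f = Ideal.span (Set.range fun j => rename Sum.inl (f j)) := by
  have h (j : Fin k) : pderiv (Sum.inr j) (bigF N k f) = rename Sum.inl (f j) := by
    simp [bigF, pderiv_inr_rename_inl, pderiv_X, Pi.single_apply]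
  simp_rw [Jprime, h]

lemma Jprime_eq_map : Jprime N k f =
    (Ideal.span (Set.range f)).map (rename (R := ℂ) (Sum.inl : _ → Fin (N + k + 1) ⊕ Fin k)) := by
  rw [Jprime_eq_span, Ideal.map_span, ← Set.range_comp, Function.comp_def]

/-- The coefficient of `w_j` in the expansion of an element of `S` in the variables `w`. -/
def wCoeff (N k : ℕ) (j : Fin k) : SRing N k →ₗ[ℂ] MvPolynomial (Fin (N + k + 1)) ℂ :=
  (aeval (Sum.elim X 0)).toLinearMap ∘ₗ (pderiv (Sum.inr j)).toLinearMap

lemma wCoeff_mul_rename (j : Fin k) (a : SRing N k) (p : MvPolynomial (Fin (N + k + 1)) ℂ) :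
    wCoeff N k j (a * rename Sum.inl p) = wCoeff N k j a * p := by
  have h : aeval (Sum.elim X 0 : _ ⊕ Fin k → _) (rename Sum.inl p) = p := by
    rw [aeval_rename, Sum.elim_comp_inl, aeval_X_left_apply]
  simp only [wCoeff, LinearMap.comp_apply, AlgHom.toLinearMap_apply, Derivation.coeFn_coe,
    Derivation.leibniz, pderiv_inr_rename_inl, smul_eq_mul, mul_zero, zero_add, map_mul, h,
    mul_comm p]

lemma wCoeff_X (i j : Fin k) : wCoeff N k j (X (Sum.inr i)) = if i = j then 1 else 0 := by
  simp [wCoeff, pderiv_X, Pi.single_apply, eq_comm, apply_ite]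

lemma wCoeff_mem_of_mem_Jprime (j : Fin k) {a : SRing N k} (ha : a ∈ Jprime N k f) :
    wCoeff N k j a ∈ Ideal.span (Set.range f) := by
  rw [Jprime_eq_span, Ideal.mem_span_range_iff_exists_fun] at ha
  obtain ⟨c, rfl⟩ := ha
  simp_rw [map_sum, wCoeff_mul_rename]
  exact sum_mem fun i _ => Ideal.mul_mem_left _ _ (Ideal.subset_span ⟨i, rfl⟩)

/-- The map `(g_j)_j ↦ ∑ w_j g_j` from a power of `ℂ[z] ⧸ (f)` to `R'`. -/
def wCombination (f : Fin k → MvPolynomial (Fin (N + k + 1)) ℂ) :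
    (Fin k → MvPolynomial (Fin (N + k + 1)) ℂ ⧸ Ideal.span (Set.range f)) →ₗ[ℂ]
      SRing N k ⧸ Jprime N k f :=
  ∑ j, LinearMap.mulLeft ℂ (Ideal.Quotient.mk _ (X (Sum.inr j))) ∘ₗ
    (Ideal.quotientMapₐ (Jprime N k f) (rename (R := ℂ) Sum.inl)
      (Ideal.map_le_iff_le_comap.1 Jprime_eq_map.ge)).toLinearMap ∘ₗ LinearMap.proj j

lemma wCombination_mk (p : Fin k → MvPolynomial (Fin (N + k + 1)) ℂ) :
    wCombination f (fun j => Ideal.Quotient.mk _ (p j)) =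
      Ideal.Quotient.mk _ (∑ j, X (Sum.inr j) * rename Sum.inl (p j)) := by
  simp [wCombination]

lemma wCombination_injective : Function.Injective (wCombination f) := by
  rw [injective_iff_map_eq_zero]
  intro g hg
  choose p hp using fun j => Ideal.Quotient.mk_surjective (g j)
  obtain rfl : (fun j => Ideal.Quotient.mk _ (p j)) = g := funext hp
  rw [wCombination_mk, Ideal.Quotient.eq_zero_iff_mem] at hg
  ext j
  refine Ideal.Quotient.eq_zero_iff_mem.2 ?_
  simpa [wCoeff_mul_rename, wCoeff_X] using wCoeff_mem_of_mem_Jprime j hg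

lemma weight_wt (m : Fin (N + k + 1) ⊕ Fin k →₀ ℕ) :
    Finsupp.weight (wt N k d) m = (∑ j, (m (Sum.inr j) : ℤ),
      ∑ s, (m (Sum.inl s) : ℤ) - ∑ j, (m (Sum.inr j) : ℤ) * d j) := by
  simp [Finsupp.weight_eq_sum, wt, Prod.ext_iff, Prod.fst_sum, Prod.snd_sum, sub_eq_add_neg]

lemma rename_inl_isWeightedHomogeneous {p : MvPolynomial (Fin (N + k + 1)) ℂ} {e : ℕ}
    (hp : p.IsHomogeneous e) :
    (rename (Sum.inl : _ → Fin (N + k + 1) ⊕ Fin k) p).IsWeightedHomogeneous (wt N k d)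
      (0, (e : ℤ)) := by
  intro m hm
  obtain ⟨u, rfl, hu⟩ := coeff_rename_ne_zero _ _ _ hm
  replace hu : ∑ s, u s = e := by simpa [Finsupp.weight_eq_sum] using hp hu
  have hr (j : Fin k) : u.mapDomain (Sum.inl : _ → Fin (N + k + 1) ⊕ Fin k) (Sum.inr j) = 0 :=
    Finsupp.mapDomain_of_notMem_range _ _ (by simp)
  simp [weight_wt, hr, Finsupp.mapDomain_apply Sum.inl_injective, ← hu]

lemma exists_eq_single_add_mapDomain_of_weight {m : Fin (N + k + 1) ⊕ Fin k →₀ ℕ} {q : ℤ}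
    (hm : Finsupp.weight (wt N k d) m = (1, q)) :
    ∃ (j : Fin k) (m' : Fin (N + k + 1) →₀ ℕ), (m'.degree : ℤ) = d j + q ∧
      m = Finsupp.single (Sum.inr j) 1 + m'.mapDomain Sum.inl := by
  rw [weight_wt, Prod.mk.injEq] at hm
  obtain ⟨h1, h2⟩ := hm
  norm_cast at h1
  obtain ⟨j, hj⟩ : ∃ j, m (Sum.inr j) ≠ 0 := by
    by_contra! h
    simp [h] at h1
  have herase := Finset.add_sum_erase Finset.univ (fun j => m (Sum.inr j)) (Finset.mem_univ j)
  have hj1 : m (Sum.inr j) = 1 := by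
    beta_reduce at herase
    omega
  have hne (i : Fin k) (hi : i ≠ j) : m (Sum.inr i) = 0 := by
    have hz : ∑ x ∈ Finset.univ.erase j, m (Sum.inr x) = 0 := by
      beta_reduce at herase
      omega
    exact Finset.sum_eq_zero_iff.1 hz i (by simp [hi])
  refine ⟨j, Finsupp.equivFunOnFinite.symm fun s => m (Sum.inl s), ?_, ?_⟩
  · rw [Finset.sum_eq_single (s := Finset.univ) (f := fun x => (m (Sum.inr x) : ℤ) * (d x : ℤ)) j
      (fun i _ hi => by simp [hne i hi]) (by simp), hj1] at h2
    simp only [Finsupp.degree_eq_sum, Finsupp.equivFunOnFinite_symm_apply_apply]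
    push_cast at h2 ⊢
    linarith
  · ext (s | i)
    · simp [Finsupp.mapDomain_apply Sum.inl_injective]
    · rw [Finsupp.add_apply, Finsupp.mapDomain_of_notMem_range _ _ (by simp), add_zero,
        Finsupp.single_apply]
      split_ifs with h
      · rw [← h, hj1]
      · exact hne i fun h' => h (by rw [h'])

/-- The submodule of those `g` for which `w_j g` has bidegree `(1, -i)`. -/
def wFactor (d : Fin k → ℕ) (f : Fin k → MvPolynomial (Fin (N + k + 1)) ℂ) (i : ℕ) (j : Fin k) :
    Submodule ℂ (MvPolynomial (Fin (N + k + 1)) ℂ ⧸ Ideal.span (Set.range f)) :=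
  if i ≤ d j then quotientPart (Ideal.span (Set.range f)) (d j - i) else ⊥

lemma wFactor_of_le {i : ℕ} {j : Fin k} (h : i ≤ d j) :
    wFactor d f i j = quotientPart (Ideal.span (Set.range f)) (d j - i) :=
  if_pos h

lemma wFactor_of_not_le {i : ℕ} {j : Fin k} (h : ¬ i ≤ d j) : wFactor d f i j = ⊥ :=
  if_neg h

instance (i : ℕ) (j : Fin k) : Module.Finite ℂ (wFactor d f i j) := by
  by_cases h : i ≤ d j
  · rw [wFactor_of_le h]
    infer_instance
  · rw [wFactor_of_not_le h]
    infer_instance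

lemma R'comp_eq_map_pi (i : ℕ) : R'comp N k d f 1 (-(i : ℤ)) =
    (Submodule.pi Set.univ (wFactor d f i)).map (wCombination f) := by
  apply le_antisymm
  · rintro _ ⟨v, hv, rfl⟩
    rw [v.as_sum, map_sum]
    refine sum_mem fun m hm => ?_
    obtain ⟨j, m', hdeg, hmm'⟩ :=
      exists_eq_single_add_mapDomain_of_weight (hv (mem_support_iff.1 hm))
    refine ⟨Pi.single j (Ideal.Quotient.mk _ (monomial m' (coeff m v))), ?_, ?_⟩
    · intro l _
      rcases eq_or_ne l j with rfl | hl
      · rw [Pi.single_eq_same, SetLike.mem_coe, wFactor_of_le (by omega)]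
        exact ⟨_, isHomogeneous_monomial _ (by omega), rfl⟩
      · rw [Pi.single_eq_of_ne hl]
        exact zero_mem _
    · have : (Pi.single j (Ideal.Quotient.mk (Ideal.span (Set.range f))
          (monomial m' (coeff m v))) : Fin k → _) =
          fun l => Ideal.Quotient.mk _ ((Pi.single j (monomial m' (coeff m v)) : Fin k → _) l) := by
        ext l
        rcases eq_or_ne l j with rfl | hl <;> simp [*]
      rw [this, wCombination_mk, Finset.sum_eq_single j (by intros; simp [*]) (by simp),
        Pi.single_eq_same, rename_monomial, X, monomial_mul, one_mul, ← hmm']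
      rfl
  · rintro _ ⟨g, hg, rfl⟩
    rw [wCombination, LinearMap.sum_apply]
    refine sum_mem fun j _ => ?_
    have hgj := hg j trivial
    by_cases h : i ≤ d j
    · rw [SetLike.mem_coe, wFactor_of_le h] at hgj
      obtain ⟨p, hp, hpg⟩ := hgj
      refine ⟨X (Sum.inr j) * rename Sum.inl p, ?_, ?_⟩
      · have hw := (isWeightedHomogeneous_X ℂ (wt N k d) (Sum.inr j)).mul
          (rename_inl_isWeightedHomogeneous hp)
        have hdeg : wt N k d (Sum.inr j) + (0, ((d j - i : ℕ) : ℤ)) = (1, -(i : ℤ)) := by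
          simp [wt, Nat.cast_sub h, ← add_sub_assoc]
        rwa [hdeg] at hw
      · simp [← hpg]
    · rw [SetLike.mem_coe, wFactor_of_not_le h, Submodule.mem_bot] at hgj
      simp [hgj]

lemma finrank_R'comp_one (i : ℕ) : Module.finrank ℂ (R'comp N k d f 1 (-(i : ℤ))) =
    ∑ j, Module.finrank ℂ (wFactor d f i j) := by
  rw [R'comp_eq_map_pi, ← (Submodule.equivMapOfInjective _ wCombination_injective _).finrank_eq,
    ← Module.finrank_pi_fintype]
  exact LinearEquiv.finrank_eq
    { toFun := fun g j => ⟨g.1 j, g.2 j trivial⟩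
      invFun := fun g => ⟨fun j => g j, fun j _ => (g j).2⟩
      map_add' := fun _ _ => rfl
      map_smul' := fun _ _ => rfl }

end Bigraded

/-- If `f_1,…,f_k` is a regular sequence and `i(X) = N+k+1-∑ d_j ≥ 1`, then
`dim_ℂ R'_{1,-i(X)} = ∑_{j=1}^{k} ∑_{I⊆{1,…,k}} (-1)^{k-|I|} C((∑_{s∈I} d_s)+d_j-1, N+k)`. -/
theorem finrank_R'comp_eq (N k : ℕ) (hN : 1 ≤ N) (hk : 1 ≤ k)
    (d : Fin k → ℕ) (hd : ∀ j, 1 ≤ d j)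
    (f : Fin k → MvPolynomial (Fin (N + k + 1)) ℂ)
    (hfhom : ∀ j, (f j).IsHomogeneous (d j))
    (hfreg : IsRegularSeq f)
    (hiX : 1 ≤ N + k + 1 - (∑ j : Fin k, d j)) :
    (Module.finrank ℂ
        (R'comp N k d f 1 (-((N + k + 1 - (∑ j : Fin k, d j) : ℕ) : ℤ))) : ℤ)
      = ∑ j : Fin k, ∑ I ∈ (Finset.univ : Finset (Fin k)).powerset,
          (-1 : ℤ) ^ (k - I.card) *
            Nat.choose ((∑ s ∈ I, d s) + d j - 1) (N + k) := by
  rw [finrank_R'comp_one, Nat.cast_sum]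
  refine Finset.sum_congr rfl fun j _ => ?_
  have hcoeff := coeff_prod_one_sub_X_pow_mul d (n := N + k) (hd j)
    (i := N + k + 1 - ∑ j, d j) (by omega)
  have hseries := quotientHilbertSeries_span_range d f hfhom hfreg
  rw [Fintype.card_fin] at hcoeff hseries
  rw [← hcoeff, ← hseries]
  split_ifs with h
  · rw [wFactor_of_le h, quotientHilbertSeries, PowerSeries.coeff_mk]
  · rw [wFactor_of_not_le h, finrank_bot, Nat.cast_zero]
end
end

section
/- In the bigraded setup below with k = 1 (so S = ℂ[z_1,…,z_{N+2}, w]), let N ≥ 1, take f = z_1^{N+1} + z_2^{N+1} + ⋯ + z_{N+2}^{N+1} (so d = N+1), and set F = w·f. Then dim_ℂ R_{1,−1} = C(2N+1, N+1) − N − 2. -/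
open MvPolynomial

noncomputable section

/-- The bidegree-`(p,q)` component of `R = S/J(F)`. -/
def Rcomp (N k : ℕ) (d : Fin k → ℕ) (f : Fin k → MvPolynomial (Fin (N + k + 1)) ℂ)
    (p q : ℤ) : Submodule ℂ (SRing N k ⧸ Jfull N k f) :=
  Submodule.map (Ideal.Quotient.mkₐ ℂ (Jfull N k f)).toLinearMap (Scomp N k d p q)

/-- If two linear maps have the same zeros on a submodule `V`, and the second maps `V` onto its
codomain, then the image of `V` under the first has the dimension of that codomain. -/
lemma finrank_map_eq_of_forall_mem_eq_zero_iff {K M Q W : Type*} [Field K] [AddCommGroup M]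
    [Module K M] [AddCommGroup Q] [Module K Q] [AddCommGroup W] [Module K W]
    (V : Submodule K M) (g : M →ₗ[K] Q) (φ : M →ₗ[K] W)
    (hker : ∀ x ∈ V, g x = 0 ↔ φ x = 0) (hsurj : ∀ y, ∃ x ∈ V, φ x = y) :
    Module.finrank K (V.map g) = Module.finrank K W := by
  have hk : LinearMap.ker (g ∘ₗ V.subtype) = LinearMap.ker (φ ∘ₗ V.subtype) := by
    ext x
    simpa using hker x x.2
  have hr : LinearMap.range (g ∘ₗ V.subtype) = V.map g := by
    rw [LinearMap.range_comp, Submodule.range_subtype]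
  have hs : Function.Surjective (φ ∘ₗ V.subtype) := fun y => by
    obtain ⟨x, hx, rfl⟩ := hsurj y
    exact ⟨⟨x, hx⟩, rfl⟩
  rw [← hr, ← (g ∘ₗ V.subtype).quotKerEquivRange.finrank_eq, hk]
  exact ((φ ∘ₗ V.subtype).quotKerEquivOfSurjective hs).finrank_eq

/-- The exponent of `w · z^t`. -/
def wExponent (N : ℕ) (t : Fin (N + 1 + 1) →₀ ℕ) : Fin (N + 1 + 1) ⊕ Fin 1 →₀ ℕ :=
  Finsupp.sumElim t (Finsupp.single 0 1)

@[simp] lemma wExponent_inl (N : ℕ) (t : Fin (N + 1 + 1) →₀ ℕ) (s : Fin (N + 1 + 1)) :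
    wExponent N t (Sum.inl s) = t s := rfl

@[simp] lemma wExponent_inr (N : ℕ) (t : Fin (N + 1 + 1) →₀ ℕ) :
    wExponent N t (Sum.inr 0) = 1 := by
  simp [wExponent]

lemma wExponent_injective (N : ℕ) : Function.Injective (wExponent N) := fun t u h => by
  ext s
  simpa using DFunLike.congr_fun h (Sum.inl s)

lemma wExponent_single (N n : ℕ) (s : Fin (N + 1 + 1)) :
    wExponent N (Finsupp.single s n)
      = Finsupp.single (Sum.inr 0) 1 + Finsupp.single (Sum.inl s) n := by
  ext (i | i)
  · simp [Finsupp.single_apply]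
  · simp [Subsingleton.elim i 0]

/-- The monomials of bidegree `(1, -1)` are the `w · z^t` with `|t| = N`. -/
lemma weight_wt_eq_iff (N : ℕ) (m : Fin (N + 1 + 1) ⊕ Fin 1 →₀ ℕ) :
    Finsupp.weight (wt N 1 fun _ => N + 1) m = (1, -1) ↔
      ∃ t : Fin (N + 1 + 1) →₀ ℕ, ∑ s, t s = N ∧ m = wExponent N t := by
  have hw : Finsupp.weight (wt N 1 fun _ => N + 1) m
      = ((m (Sum.inr 0) : ℤ),
          ∑ s, (m (Sum.inl s) : ℤ) - (m (Sum.inr 0) : ℤ) * ((N : ℤ) + 1)) := by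
    rw [Finsupp.weight_apply, Finsupp.sum_fintype _ _ (by simp)]
    ext
    · simp [wt, Prod.fst_sum]
    · simp [wt, Prod.snd_sum]
      ring
  rw [hw, Prod.mk.injEq]
  constructor
  · rintro ⟨h1, h2⟩
    refine ⟨m.comapDomain Sum.inl Sum.inl_injective.injOn, ?_, ?_⟩
    · rw [h1] at h2
      zify
      simp only [Finsupp.comapDomain_apply]
      linarith
    · ext (i | i)
      · simp
      · obtain rfl := Subsingleton.elim i 0
        simpa using h1
  · rintro ⟨t, ht, rfl⟩
    simp [← ht]

/-- The exponents of degree `N` in `z` other than those of the pure powers `z_s^N`. -/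
def mixedExponents (N : ℕ) : Finset (Fin (N + 1 + 1) →₀ ℕ) :=
  Finset.finsuppAntidiag Finset.univ N \ Finset.univ.image fun s => Finsupp.single s N

lemma mem_mixedExponents {N : ℕ} {t : Fin (N + 1 + 1) →₀ ℕ} :
    t ∈ mixedExponents N ↔ ∑ s, t s = N ∧ ∀ s, t ≠ Finsupp.single s N := by
  simp [mixedExponents, eq_comm]

lemma card_mixedExponents (N : ℕ) (hN : 1 ≤ N) :
    ((mixedExponents N).card : ℤ) = Nat.choose (2 * N + 1) (N + 1) - N - 2 := by
  have hinj : Function.Injective fun s : Fin (N + 1 + 1) => Finsupp.single s N :=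
    Finsupp.single_left_injective (by omega)
  have hsub : (Finset.univ.image fun s : Fin (N + 1 + 1) => Finsupp.single s N)
      ⊆ Finset.finsuppAntidiag Finset.univ N := by
    intro t ht
    obtain ⟨s, -, rfl⟩ := Finset.mem_image.1 ht
    simp
  rw [mixedExponents, Finset.cast_card_sdiff hsub, Finset.card_finsuppAntidiag_nat_eq_choose,
    Finset.card_image_of_injective _ hinj]
  have hc : (N + 1 + 1 + N - 1).choose N = (2 * N + 1).choose (N + 1) := by
    rw [show N + 1 + 1 + N - 1 = 2 * N + 1 by omega]
    exact Nat.choose_symm_of_eq_add (by omega)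
  simp only [Finset.card_univ, Fintype.card_fin, hc]
  push_cast
  ring

/-- The Fermat polynomial `z_1^{N+1} + ⋯ + z_{N+2}^{N+1}`, as a family indexed by `Fin 1`. -/
abbrev fermat (N : ℕ) : Fin 1 → MvPolynomial (Fin (N + 1 + 1)) ℂ :=
  fun _ => ∑ s : Fin (N + 1 + 1), (X s : MvPolynomial (Fin (N + 1 + 1)) ℂ) ^ (N + 1)

lemma pderiv_inr_bigF_fermat (N : ℕ) :
    pderiv (Sum.inr 0) (bigF N 1 (fermat N))
      = ∑ s, monomial (Finsupp.single (Sum.inl s) (N + 1)) (1 : ℂ) := by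
  simp only [← X_pow_eq_monomial]
  simp [bigF, pderiv_X]

lemma pderiv_inl_bigF_fermat (N : ℕ) (s : Fin (N + 1 + 1)) :
    pderiv (Sum.inl s) (bigF N 1 (fermat N))
      = monomial (wExponent N (Finsupp.single s N)) ((N : ℂ) + 1) := by
  have h : (monomial (wExponent N (Finsupp.single s N)) ((N : ℂ) + 1) : SRing N 1)
      = X (Sum.inr 0) * (C ((N : ℂ) + 1) * X (Sum.inl s) ^ N) := by
    rw [wExponent_single, X, X_pow_eq_monomial, C_mul_monomial, monomial_mul]
    simp
  rw [h]
  simp [bigF, pderiv_X, Pi.single_apply]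

lemma coeff_eq_zero_of_mem_Jfull_fermat {N : ℕ} {p : SRing N 1} (hp : p ∈ Jfull N 1 (fermat N))
    {t : Fin (N + 1 + 1) →₀ ℕ} (ht : t ∈ mixedExponents N) : coeff (wExponent N t) p = 0 := by
  obtain ⟨hsum, hne⟩ := mem_mixedExponents.1 ht
  have hle : ∀ s, t s ≤ N := fun s =>
    (Finset.single_le_sum (f := t) (fun _ _ => Nat.zero_le _) (Finset.mem_univ s)).trans_eq hsum
  obtain ⟨a, rfl⟩ := Ideal.mem_span_range_iff_exists_fun.1 hp
  rw [coeff_sum]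
  refine Finset.sum_eq_zero ?_
  rintro (s | j) -
  · rw [pderiv_inl_bigF_fermat, coeff_mul_monomial', if_neg]
    intro h
    have hs : N ≤ t s := by simpa using h (Sum.inl s)
    refine hne s (Finsupp.ext fun i => ?_)
    have hz : ∑ i ∈ Finset.univ.erase s, t i = 0 := by
      have := Finset.add_sum_erase Finset.univ t (Finset.mem_univ s)
      omega
    by_cases hi : i = s
    · subst hi
      simpa using le_antisymm (hle i) hs
    · rw [Finsupp.single_eq_of_ne hi]
      exact Finset.sum_eq_zero_iff.1 hz i (by simp [hi])
  · obtain rfl := Subsingleton.elim j 0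
    rw [pderiv_inr_bigF_fermat, Finset.mul_sum, coeff_sum]
    refine Finset.sum_eq_zero fun s _ => ?_
    rw [coeff_mul_monomial', if_neg]
    intro h
    have hs : N + 1 ≤ t s := by simpa using h (Sum.inl s)
    exact absurd (hle s) (by omega)

lemma mem_Jfull_fermat_of_coeff_eq_zero {N : ℕ} {p : SRing N 1}
    (hp : p ∈ Scomp N 1 (fun _ => N + 1) 1 (-1))
    (h : ∀ t ∈ mixedExponents N, coeff (wExponent N t) p = 0) : p ∈ Jfull N 1 (fermat N) := by
  rw [p.as_sum]
  refine Ideal.sum_mem _ fun m hm => ?_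
  have hm0 : coeff m p ≠ 0 := mem_support_iff.1 hm
  obtain ⟨t, ht, rfl⟩ := (weight_wt_eq_iff N m).1 (hp hm0)
  obtain ⟨s, rfl⟩ : ∃ s, t = Finsupp.single s N := by
    by_contra! hne
    exact hm0 (h t (mem_mixedExponents.2 ⟨ht, hne⟩))
  have hN : (N : ℂ) + 1 ≠ 0 := Nat.cast_add_one_ne_zero N
  have hgen : pderiv (Sum.inl s) (bigF N 1 (fermat N)) ∈ Jfull N 1 (fermat N) :=
    Ideal.subset_span ⟨_, rfl⟩
  rw [pderiv_inl_bigF_fermat] at hgen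
  have := Ideal.mul_mem_left _
    (C (coeff (wExponent N (Finsupp.single s N)) p / ((N : ℂ) + 1))) hgen
  rwa [C_mul_monomial, div_mul_cancel₀ _ hN] at this

/-- **Corollary 3.6, second case.** For `k = 1`, the Fermat polynomial
`f = z_1^{N+1} + ⋯ + z_{N+2}^{N+1}` of degree `d = N+1`, and `F = w·f`, one has
`dim_ℂ R_{1,-1} = C(2N+1, N+1) - N - 2`. -/
theorem finrank_Rcomp_fermat (N : ℕ) (hN : 1 ≤ N) :
    (Module.finrank ℂ
        (Rcomp N 1 (fun _ => N + 1)
          (fun _ => ∑ s : Fin (N + 1 + 1), (X s : MvPolynomial (Fin (N + 1 + 1)) ℂ) ^ (N + 1))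
          1 (-1)) : ℤ)
      = Nat.choose (2 * N + 1) (N + 1) - N - 2 := by
  let φ : SRing N 1 →ₗ[ℂ] (mixedExponents N → ℂ) :=
    LinearMap.pi fun t => lcoeff ℂ (wExponent N t)
  have hφ : ∀ p t, φ p t = coeff (wExponent N t) p := fun _ _ => rfl
  have key := finrank_map_eq_of_forall_mem_eq_zero_iff (Scomp N 1 (fun _ => N + 1) 1 (-1))
    (Ideal.Quotient.mkₐ ℂ (Jfull N 1 (fermat N))).toLinearMap φ ?_ ?_
  · rw [Rcomp, key, Module.finrank_fintype_fun_eq_card, Fintype.card_coe,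
      card_mixedExponents N hN]
  · intro p hp
    rw [AlgHom.toLinearMap_apply, Ideal.Quotient.mkₐ_eq_mk, Ideal.Quotient.eq_zero_iff_mem]
    exact ⟨fun h => funext fun t => coeff_eq_zero_of_mem_Jfull_fermat h t.2,
      fun h => mem_Jfull_fermat_of_coeff_eq_zero hp fun t ht => congrFun h ⟨t, ht⟩⟩
  · intro y
    refine ⟨∑ t : mixedExponents N, monomial (wExponent N t) (y t), Submodule.sum_mem _ fun t _ => ?_, ?_⟩
    · exact isWeightedHomogeneous_monomial _ _ _
        ((weight_wt_eq_iff N _).2 ⟨t, (mem_mixedExponents.1 t.2).1, rfl⟩)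
    · ext t
      simp [hφ, coeff_sum, coeff_monomial, (wExponent_injective N).eq_iff]
end
end

section
/- For all integers k ≥ 1, d_1,…,d_k ≥ 1, and every natural number l ≥ 0, one has ∑_{j=1}^{k} ∑_{i_1=0}^{d_1−1} ⋯ ∑_{i_k=0}^{d_k−1} C(d_1,i_1)·…·C(d_k,i_k)·C(d_j−1, i_1+…+i_k+l) = ∑_{j=1}^{k} ∑_{I⊆{1,…,k}} (−1)^{k−|I|} C((∑_{s∈I} d_s) + d_j − 1, (d_1+…+d_k) + l). -/
open Polynomial in
/-- The binomial expansion of `(X + 1) ^ n - 1`, in which the constant term cancels. -/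
theorem X_add_one_pow_sub_one_eq_sum (n : ℕ) :
    ((X + 1 : ℤ[X]) ^ n - 1) =
      ∑ i ∈ Finset.range n, C (Nat.choose n i : ℤ) * X ^ (n - i) := by
  rw [add_comm, add_pow, Finset.sum_range_succ]
  simp [mul_comm]

open Polynomial in
/-- Two expansions of the coefficient of degree `∑ d + l` in
`(X + 1) ^ m * ∏ t, ((X + 1) ^ d t - 1)`. -/
theorem sum_prod_choose_mul_choose {ι : Type*} [Fintype ι] [DecidableEq ι] (d : ι → ℕ)
    (m l : ℕ) :
    ∑ i ∈ Fintype.piFinset (fun t : ι => Finset.range (d t)),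
        ((∏ t : ι, Nat.choose (d t) (i t)) * Nat.choose m ((∑ t : ι, i t) + l) : ℤ)
      = ∑ I ∈ (Finset.univ : Finset ι).powerset,
          (-1 : ℤ) ^ (Fintype.card ι - I.card) *
            Nat.choose ((∑ s ∈ I, d s) + m) ((∑ t : ι, d t) + l) := by
  trans ((X + 1 : ℤ[X]) ^ m * ∏ t, ((X + 1) ^ d t - 1)).coeff ((∑ t, d t) + l)
  · simp_rw [X_add_one_pow_sub_one_eq_sum, Finset.prod_univ_sum, Finset.mul_sum,
      finsetSum_coeff]
    refine Finset.sum_congr rfl fun i hi => ?_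
    have hle : ∀ t, i t ≤ d t := fun t =>
      (Finset.mem_range.mp (Fintype.mem_piFinset.mp hi t)).le
    have hdeg : (∑ t, d t) + l = ((∑ t, i t) + l) + ∑ t, (d t - i t) := by
      have h : ∑ t, d t = ∑ t, i t + ∑ t, (d t - i t) := by
        rw [← Finset.sum_add_distrib]
        exact Finset.sum_congr rfl fun t _ => (Nat.add_sub_of_le (hle t)).symm
      omega
    rw [Finset.prod_mul_distrib, Finset.prod_pow_eq_pow_sum, ← map_prod, mul_left_comm,
      coeff_C_mul, hdeg, coeff_mul_X_pow, coeff_X_add_one_pow, Nat.cast_prod]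
  · simp_rw [sub_eq_add_neg, Finset.prod_add, Finset.mul_sum, finsetSum_coeff]
    refine Finset.sum_congr rfl fun I _ => ?_
    have hpoly : (X + 1 : ℤ[X]) ^ m * ((∏ t ∈ I, (X + 1) ^ d t) * ∏ _t ∈ Finset.univ \ I, (-1)) =
        C ((-1) ^ (Fintype.card ι - I.card)) * (X + 1) ^ ((∑ s ∈ I, d s) + m) := by
      rw [Finset.prod_pow_eq_pow_sum, Finset.prod_const, Finset.card_univ_sdiff, pow_add]
      simp only [map_pow, map_neg, map_one]
      ring
    rw [hpoly, coeff_C_mul, coeff_X_add_one_pow]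

/-- The combinatorial identity from the proof of the main theorem: for `k ≥ 1`,
`d j ≥ 1`, and `l ≥ 0`,
`∑_j ∑_{0 ≤ i_t ≤ d_t - 1} (∏ t C(d_t, i_t)) C(d_j - 1, ∑ i_t + l)
  = ∑_j ∑_{I ⊆ {1,…,k}} (-1)^{k-|I|} C((∑_{s ∈ I} d_s) + d_j - 1, (∑ d_t) + l)`. -/
theorem exceptional_components_identity (k : ℕ) (hk : 1 ≤ k) (d : Fin k → ℕ)
    (hd : ∀ j, 1 ≤ d j) (l : ℕ) :
    ∑ j : Fin k, ∑ i ∈ Fintype.piFinset (fun t : Fin k => Finset.range (d t)),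
        ((∏ t : Fin k, Nat.choose (d t) (i t)) *
          Nat.choose (d j - 1) ((∑ t : Fin k, i t) + l) : ℤ)
      = ∑ j : Fin k, ∑ I ∈ (Finset.univ : Finset (Fin k)).powerset,
          (-1 : ℤ) ^ (k - I.card) *
            Nat.choose ((∑ s ∈ I, d s) + d j - 1) ((∑ t : Fin k, d t) + l) := by
  refine Finset.sum_congr rfl fun j _ => ?_
  simp_rw [Nat.add_sub_assoc (hd j)]
  simpa only [Fintype.card_fin] using sum_prod_choose_mul_choose d (d j - 1) l
end
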